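/- There are exactly six Segre collections: the number of sets consisting of five pairwise disjoint matchings of Fin 6 equals 6. -/

import Mathlib

/-- A matching of `Fin 6`: a fixed-point-free involution. -/
def IsMatching (σ : Equiv.Perm (Fin 6)) : Prop :=
  (∀ x, σ (σ x) = x) ∧ ∀ x, σ x ≠ x

/-- Two matchings are disjoint if they share no pair. -/
def DisjointMatchings (σ τ : Equiv.Perm (Fin 6)) : Prop :=
  ∀ x, σ x ≠ τ x

/-- A Segre collection: a set of five pairwise disjoint matchings of `Fin 6`. -/
def IsSegreCollection (S : Finset (Equiv.Perm (Fin 6))) : Prop :=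
  S.card = 5 ∧ (∀ σ ∈ S, IsMatching σ) ∧
    ∀ σ ∈ S, ∀ τ ∈ S, σ ≠ τ → DisjointMatchings σ τ

/-- `tab i k` is the `k`-th matching that pairs `0` with `i + 1`. -/
def tab : Fin 5 → Fin 3 → Fin 6 → Fin 6 :=
  ![![![1, 0, 3, 2, 5, 4], ![1, 0, 4, 5, 2, 3], ![1, 0, 5, 4, 3, 2]],
    ![![2, 3, 0, 1, 5, 4], ![2, 4, 0, 5, 1, 3], ![2, 5, 0, 4, 3, 1]],
    ![![3, 2, 1, 0, 5, 4], ![3, 4, 5, 0, 1, 2], ![3, 5, 4, 0, 2, 1]],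
    ![![4, 2, 1, 5, 0, 3], ![4, 3, 5, 1, 0, 2], ![4, 5, 3, 2, 0, 1]],
    ![![5, 2, 1, 4, 3, 0], ![5, 3, 4, 1, 2, 0], ![5, 4, 3, 2, 1, 0]]]

lemma tab_invol : ∀ i k x, tab i k (tab i k x) = x := by decide +kernel

lemma tab_ne : ∀ i k x, tab i k x ≠ x := by decide +kernel

lemma tab_zero : ∀ i k, tab i k 0 = i.succ := by decide +kernel

lemma tab_inj : ∀ i k l, tab i k = tab i l → k = l := by decide +kernel

/-- Every matching is in the table. -/
lemma tab_complete : ∀ σ : Equiv.Perm (Fin 6), (∀ x, σ (σ x) = x) → (∀ x, σ x ≠ x) →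
    ∀ i : Fin 5, σ 0 = i.succ → ∃ k, ∀ x, σ x = tab i k x := by decide +kernel

/-- The matchings of the table as permutations. -/
def matchPerm (i : Fin 5) (k : Fin 3) : Equiv.Perm (Fin 6) :=
  Function.Involutive.toPerm (tab i k) (tab_invol i k)

lemma matchPerm_apply (i k x) : matchPerm i k x = tab i k x := rfl

/-- A choice of one matching through each pair `{0, i + 1}` that is pairwise disjoint. -/
abbrev Good (c : Fin 5 → Fin 3) : Prop :=
  ∀ i j, i ≠ j → ∀ x, tab i (c i) x ≠ tab j (c j) x

lemma good_card : Fintype.card {c : Fin 5 → Fin 3 // Good c} = 6 := by decide +kernel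

lemma matchPerm_injective (c : Fin 5 → Fin 3) : Function.Injective fun i => matchPerm i (c i) := by
  intro i j h
  have h0 := congrArg (fun σ : Equiv.Perm (Fin 6) => σ 0) h
  simpa [matchPerm_apply, tab_zero] using h0

/-- The collection attached to a choice. -/
def coll (c : Fin 5 → Fin 3) : Finset (Equiv.Perm (Fin 6)) :=
  Finset.univ.image fun i => matchPerm i (c i)

lemma coll_card (c : Fin 5 → Fin 3) : (coll c).card = 5 := by
  rw [coll, Finset.card_image_of_injective _ (matchPerm_injective c)]; simp

lemma coll_segre (c : Fin 5 → Fin 3) (hc : Good c) : IsSegreCollection (coll c) := by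
  refine ⟨coll_card c, ?_, ?_⟩
  · intro σ hσ
    obtain ⟨i, -, rfl⟩ := Finset.mem_image.1 hσ
    exact ⟨tab_invol i _, tab_ne i _⟩
  · intro σ hσ τ hτ hne
    obtain ⟨i, -, rfl⟩ := Finset.mem_image.1 hσ
    obtain ⟨j, -, rfl⟩ := Finset.mem_image.1 hτ
    exact hc i j (fun h => hne (by subst h; rfl))

lemma coll_injective : Function.Injective coll := by
  intro c d h
  funext i
  have hm : matchPerm i (c i) ∈ coll d := h ▸ Finset.mem_image_of_mem _ (Finset.mem_univ i)
  obtain ⟨j, -, hj⟩ := Finset.mem_image.1 hm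
  have h0 := congrArg (fun σ : Equiv.Perm (Fin 6) => σ 0) hj
  have hji : j = i := by simpa [matchPerm_apply, tab_zero] using h0
  subst hji
  exact (tab_inj j _ _ (funext fun x => congrArg (fun σ : Equiv.Perm (Fin 6) => σ x) hj)).symm

lemma coll_surjective (S : Finset (Equiv.Perm (Fin 6))) (hS : IsSegreCollection S) :
    ∃ c, Good c ∧ coll c = S := by
  obtain ⟨hcard, hm, hd⟩ := hS
  have himg : S.image (fun σ => σ 0) = Finset.univ.erase 0 := by
    apply Finset.eq_of_subset_of_card_le
    · intro y hy
      obtain ⟨σ, hσ, rfl⟩ := Finset.mem_image.1 hy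
      simpa using (hm σ hσ).2 0
    · rw [Finset.card_image_of_injOn, hcard]
      · simp
      · intro σ hσ τ hτ h
        by_contra hne
        exact hd σ hσ τ hτ hne 0 h
  have hex : ∀ i : Fin 5, ∃ k, matchPerm i k ∈ S := by
    intro i
    have hi : i.succ ∈ S.image (fun σ => σ 0) := by
      rw [himg]; simp
    obtain ⟨σ, hσ, h0⟩ := Finset.mem_image.1 hi
    obtain ⟨k, hk⟩ := tab_complete σ (hm σ hσ).1 (hm σ hσ).2 i h0
    refine ⟨k, ?_⟩
    have : matchPerm i k = σ := Equiv.ext fun x => (hk x).symm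
    rwa [this]
  choose c hc using hex
  refine ⟨c, fun i j hij => ?_, ?_⟩
  · exact hd _ (hc i) _ (hc j) fun h => hij (matchPerm_injective c h)
  · apply Finset.eq_of_subset_of_card_le
    · intro σ hσ
      obtain ⟨i, -, rfl⟩ := Finset.mem_image.1 hσ
      exact hc i
    · rw [hcard, coll_card]

/-- There are exactly six Segre collections. -/
theorem segre_collections_card :
    Nat.card {S : Finset (Equiv.Perm (Fin 6)) // IsSegreCollection S} = 6 := by
  refine Eq.trans ?_ (Nat.card_eq_fintype_card.trans good_card)
  symm
  refine Nat.card_eq_of_bijective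
    (fun c : {c : Fin 5 → Fin 3 // Good c} => ⟨coll c.1, coll_segre c.1 c.2⟩) ⟨?_, ?_⟩
  · intro c d h
    exact Subtype.ext (coll_injective (congrArg Subtype.val h))
  · rintro ⟨S, hS⟩
    obtain ⟨c, hc, rfl⟩ := coll_surjective S hS
    exact ⟨⟨c, hc⟩, rfl⟩
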